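/- Lipschitz's formula: for every z in the complex upper half-plane ℍ and every complex number s with Re(s) > 1, one has ∑_{n ∈ ℤ} (z + n)^{-s} = (e^{-πis/2} (2π)^s / Γ(s)) · ∑_{n=1}^{∞} n^{s-1} e^{2πinz}, where both series converge absolutely. -/

import Mathlib

open Complex Real

open MeasureTheory Set Filter Topology Asymptotics

/-- The norm of `t ^ s * exp (-(w * t))` for `t > 0` depends only on real parts. -/
lemma norm_cpow_mul_exp_neg_mul (s w : ℂ) {t : ℝ} (ht : 0 < t) :
    ‖(t : ℂ) ^ s * cexp (-(w * t))‖ = t ^ s.re * rexp (-w.re * t) := by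
  rw [norm_mul, norm_cpow_eq_rpow_re_of_pos ht, Complex.norm_exp]
  simp

lemma continuousOn_cpow_mul_exp_neg_mul (s w : ℂ) :
    ContinuousOn (fun t : ℝ ↦ (t : ℂ) ^ s * cexp (-(w * t))) (Ioi 0) := by
  refine ContinuousOn.mul (fun t ht ↦ ?_) (by fun_prop)
  exact (continuousAt_ofReal_cpow_const _ _ (Or.inr (ne_of_gt ht))).continuousWithinAt

lemma integrableOn_rpow_mul_exp_neg_mul {σ b : ℝ} (hσ : -1 < σ) (hb : 0 < b) :
    IntegrableOn (fun t : ℝ ↦ t ^ σ * rexp (-b * t)) (Ioi 0) := by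
  simpa using integrableOn_rpow_mul_exp_neg_mul_rpow hσ one_pos hb

lemma integrableOn_cpow_mul_exp_neg_mul {s w : ℂ} (hs : -1 < s.re) (hw : 0 < w.re) :
    IntegrableOn (fun t : ℝ ↦ (t : ℂ) ^ s * cexp (-(w * t))) (Ioi 0) := by
  refine Integrable.mono' (integrableOn_rpow_mul_exp_neg_mul hs hw)
    ((continuousOn_cpow_mul_exp_neg_mul s w).aestronglyMeasurable measurableSet_Ioi) ?_
  filter_upwards [ae_restrict_mem measurableSet_Ioi] with t ht
  exact (norm_cpow_mul_exp_neg_mul s w ht).le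

lemma differentiableAt_integral_cpow_mul_exp_neg_mul {s w : ℂ} (hs : -1 < s.re)
    (hw : 0 < w.re) :
    DifferentiableAt ℂ (fun w : ℂ ↦ ∫ t : ℝ in Ioi 0, (t : ℂ) ^ s * cexp (-(w * t))) w := by
  have hnhds : {u : ℂ | w.re / 2 < u.re} ∈ 𝓝 w :=
    (isOpen_lt continuous_const continuous_re).mem_nhds (by simpa using half_lt_self hw)
  refine (hasDerivAt_integral_of_dominated_loc_of_deriv_le
    (F' := fun u (t : ℝ) ↦ -((t : ℂ) ^ (s + 1) * cexp (-(u * t))))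
    (bound := fun t : ℝ ↦ t ^ (s + 1).re * rexp (-(w.re / 2) * t)) hnhds
    (.of_forall fun u ↦ (continuousOn_cpow_mul_exp_neg_mul s u).aestronglyMeasurable
      measurableSet_Ioi)
    (integrableOn_cpow_mul_exp_neg_mul hs hw)
    ((continuousOn_cpow_mul_exp_neg_mul (s + 1) w).neg.aestronglyMeasurable measurableSet_Ioi)
    ?_ (integrableOn_rpow_mul_exp_neg_mul (by simp; linarith) (half_pos hw))
    ?_).2.differentiableAt
  · filter_upwards [ae_restrict_mem measurableSet_Ioi] with t (ht : 0 < t) u (hu : _ < _)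
    rw [norm_neg, norm_cpow_mul_exp_neg_mul _ _ ht]
    gcongr
  · filter_upwards [ae_restrict_mem measurableSet_Ioi] with t (ht : 0 < t) u _
    have h := (((hasDerivAt_id u).mul_const (t : ℂ)).neg.cexp).const_mul ((t : ℂ) ^ s)
    convert! h using 1
    rw [cpow_add _ _ (by exact_mod_cast ht.ne'), cpow_one]
    simp only [id, one_mul, Pi.neg_apply]
    ring

/-- The Gamma integral rescaled by a complex number of positive real part. -/
theorem integral_cpow_mul_exp_neg_complex_mul_Ioi {s w : ℂ} (hs : 0 < s.re) (hw : 0 < w.re) :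
    ∫ t : ℝ in Ioi 0, (t : ℂ) ^ (s - 1) * cexp (-(w * t)) = w ^ (-s) * Complex.Gamma s := by
  have hopen : IsOpen {u : ℂ | 0 < u.re} := isOpen_lt continuous_const continuous_re
  have hs' : -1 < (s - 1).re := by simpa using hs
  have hL : AnalyticOnNhd ℂ
      (fun w : ℂ ↦ ∫ t : ℝ in Ioi 0, (t : ℂ) ^ (s - 1) * cexp (-(w * t))) {u | 0 < u.re} :=
    DifferentiableOn.analyticOnNhd (fun u hu ↦
      (differentiableAt_integral_cpow_mul_exp_neg_mul hs' hu).differentiableWithinAt) hopen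
  have hR : AnalyticOnNhd ℂ (fun w : ℂ ↦ w ^ (-s) * Complex.Gamma s) {u | 0 < u.re} :=
    DifferentiableOn.analyticOnNhd (fun u hu ↦
      ((differentiableAt_id.cpow_const (Or.inl hu)).mul_const _).differentiableWithinAt) hopen
  refine hL.eqOn_of_preconnected_of_frequently_eq hR
    (convex_halfSpace_re_gt 0).isPreconnected (z₀ := 1) (by simp) ?_ hw
  have htend : Tendsto (fun r : ℝ ↦ (r : ℂ)) (𝓝[>] 1) (𝓝[≠] 1) := by
    refine tendsto_nhdsWithin_iff.2 ⟨?_, ?_⟩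
    · exact (continuous_ofReal.tendsto' 1 1 (by simp)).mono_left nhdsWithin_le_nhds
    · filter_upwards [self_mem_nhdsWithin] with r (hr : 1 < r)
      simpa using hr.ne'
  refine htend.frequently (Eventually.frequently ?_)
  filter_upwards [self_mem_nhdsWithin] with r (hr : 1 < r)
  have hr0 : 0 < r := by linarith
  rw [Complex.integral_cpow_mul_exp_neg_mul_Ioi hs hr0, one_div, inv_cpow, cpow_neg]
  rw [arg_ofReal_of_nonneg hr0.le]
  exact pi_pos.ne

/-- For `w` in the upper half-plane, rotating to the right half-plane is compatible with
complex powers. -/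
lemma neg_two_pi_I_mul_cpow {w : ℂ} (hw : 0 < w.im) (s : ℂ) :
    (-(2 * π * I * w)) ^ (-s) =
      cexp (π * I * s / 2) * ((2 * π : ℝ) : ℂ) ^ (-s) * w ^ (-s) := by
  have hw0 : w ≠ 0 := by rintro rfl; simp at hw
  have harg : -I ≠ 0 := by simp
  have h1 : -(2 * π * I * w) = ((2 * π : ℝ) : ℂ) * (-I * w) := by push_cast; ring
  have hlog : Complex.log (-I * w) = Complex.log (-I) + Complex.log w := by
    refine Complex.log_mul harg hw0 ?_
    have := arg_nonneg_iff.2 hw.le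
    have := arg_le_pi w
    rw [arg_neg_I]
    constructor <;> linarith [pi_pos]
  have h2 : (-I * w) ^ (-s) = cexp (π * I * s / 2) * w ^ (-s) := by
    rw [cpow_def_of_ne_zero (mul_ne_zero harg hw0), cpow_def_of_ne_zero hw0, hlog, log_neg_I,
      ← Complex.exp_add]
    congr 1
    ring
  have h2pi : ((2 * π : ℝ) : ℂ) ≠ 0 := ofReal_ne_zero.2 two_pi_pos.ne'
  rw [h1, cpow_def_of_ne_zero (mul_ne_zero h2pi (mul_ne_zero harg hw0)),
    Complex.log_ofReal_mul two_pi_pos (mul_ne_zero harg hw0), add_mul, Complex.exp_add,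
    ← cpow_def_of_ne_zero (mul_ne_zero harg hw0), h2, cpow_def_of_ne_zero h2pi,
    Complex.ofReal_log two_pi_pos.le]
  ring

lemma summable_norm_add_int_cpow (z : ℂ) {s : ℂ} (hs : 1 < s.re) :
    Summable (fun n : ℤ ↦ ‖(z + n) ^ (-s)‖) := by
  have h := EisensteinSeries.linear_isTheta_right_add 1 0 z
  simp only [Int.cast_one, one_mul, Int.cast_zero, add_zero] at h
  have h1 : (fun n : ℤ ↦ (z + n) ^ (-s)) =O[cofinite] fun n : ℤ ↦ ‖z + n‖ ^ (-s).re :=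
    (isTheta_cpow_const_rpow (fun h0 ↦ by simp at h0; linarith)).1
  have h2 : (fun n : ℤ ↦ ‖z + n‖ ^ (-s).re) =O[cofinite] fun n : ℤ ↦ |(n : ℝ)| ^ (-s.re) := by
    have habs : (fun n : ℤ ↦ ‖z + n‖) =Θ[cofinite] fun n : ℤ ↦ |(n : ℝ)| :=
      h.norm_left.norm_right
    exact (habs.rpow (.of_forall fun _ ↦ norm_nonneg _) (.of_forall fun _ ↦ abs_nonneg _)).1
  exact (summable_of_isBigO (Real.summable_abs_int_rpow hs) (h1.trans h2).norm_left)

/-- The summand on the Fourier side of Lipschitz's formula, extended by zero to the real line. -/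
noncomputable def lipschitzKernel (z s : ℂ) : ℝ → ℂ :=
  (Ioi 0).indicator fun t : ℝ ↦ (t : ℂ) ^ (s - 1) * cexp (2 * π * I * t * z)

lemma norm_lipschitzKernel_of_pos (z s : ℂ) {t : ℝ} (ht : 0 < t) :
    ‖lipschitzKernel z s t‖ = t ^ (s.re - 1) * rexp (-(2 * π * z.im) * t) := by
  have h : 2 * π * I * t * z = -(-(2 * π * I * z) * t) := by ring
  rw [lipschitzKernel, indicator_of_mem (mem_Ioi.2 ht), h, norm_cpow_mul_exp_neg_mul _ _ ht]
  simp

lemma continuous_lipschitzKernel (z : ℂ) {s : ℂ} (hs : 1 < s.re) :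
    Continuous (lipschitzKernel z s) := by
  have hs0 : 0 < (s - 1).re := by simpa using hs
  refine continuous_indicator (fun t ht ↦ ?_) ?_
  · obtain rfl : t = 0 := by simpa using ht
    rw [ofReal_zero, zero_cpow (fun h ↦ by simp [h] at hs0), zero_mul]
  · exact ((continuous_ofReal_cpow_const hs0).mul (by fun_prop)).continuousOn

lemma lipschitzKernel_isBigO (s : ℂ) {z : ℂ} (hz : 0 < z.im) :
    lipschitzKernel z s =O[cocompact ℝ] fun t : ℝ ↦ |t| ^ (-2 : ℝ) := by
  rw [cocompact_eq_atBot_atTop, isBigO_sup]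
  constructor
  · refine (EventuallyEq.isBigO ?_ : _ =O[atBot] fun _ : ℝ ↦ (0 : ℂ)).trans (isBigO_zero _ _)
    filter_upwards [eventually_le_atBot 0] with t ht
    exact indicator_of_notMem (by simpa using ht) _
  · have hb : 0 < 2 * π * z.im := by positivity
    have h := (isBigO_refl (fun t : ℝ ↦ t ^ (s.re - 1)) atTop).mul
      (isLittleO_exp_neg_mul_rpow_atTop hb (-2 - (s.re - 1))).isBigO
    refine IsBigO.of_norm_left ((h.congr' ?_ ?_))
    · filter_upwards [eventually_gt_atTop 0] with t ht
      rw [norm_lipschitzKernel_of_pos z s ht]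
    · filter_upwards [eventually_gt_atTop 0] with t ht
      rw [← Real.rpow_add ht, abs_of_pos ht]
      congr 1; ring

lemma fourier_lipschitzKernel {z s : ℂ} (hz : 0 < z.im) (hs : 0 < s.re) (x : ℝ) :
    FourierTransform.fourier (lipschitzKernel z s) x =
      cexp (π * I * s / 2) * ((2 * π : ℝ) : ℂ) ^ (-s) * Complex.Gamma s * (z - x) ^ (-s) := by
  have hw : 0 < (z - x).im := by simpa using hz
  have hre : 0 < (-(2 * π * I * (z - x))).re := by simpa using by positivity
  calc FourierTransform.fourier (lipschitzKernel z s) x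
      = ∫ t : ℝ in Ioi 0, (t : ℂ) ^ (s - 1) * cexp (-(-(2 * π * I * (z - x)) * t)) := by
        rw [Real.fourier_real_eq_integral_exp_smul, ← integral_indicator measurableSet_Ioi]
        congr 1 with t
        by_cases ht : t ∈ Ioi (0 : ℝ)
        · rw [lipschitzKernel, indicator_of_mem ht, indicator_of_mem ht, smul_eq_mul,
            mul_left_comm, ← Complex.exp_add]
          congr 2
          push_cast
          ring
        · rw [lipschitzKernel, indicator_of_notMem ht, indicator_of_notMem ht, smul_zero]
    _ = _ := by
        rw [integral_cpow_mul_exp_neg_complex_mul_Ioi hs hre, neg_two_pi_I_mul_cpow hw]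
        ring

/-- Lipschitz's formula: for `z` in the upper half-plane and `Re s > 1`,
`∑_{n ∈ ℤ} (z + n)^{-s} = (e^{-πis/2} (2π)^s / Γ(s)) · ∑_{n ≥ 1} n^{s-1} e^{2πinz}`,
both series converging absolutely. -/
theorem lipschitz_formula (z : UpperHalfPlane) (s : ℂ) (hs : 1 < s.re) :
    Summable (fun n : ℤ => ‖((z : ℂ) + n) ^ (-s)‖) ∧
    Summable (fun n : ℕ+ =>
      ‖(n : ℂ) ^ (s - 1) * Complex.exp (2 * Real.pi * Complex.I * n * z)‖) ∧
    ∑' n : ℤ, ((z : ℂ) + n) ^ (-s) =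
      Complex.exp (-Real.pi * Complex.I * s / 2) * ((2 * Real.pi : ℝ) : ℂ) ^ s /
          Complex.Gamma s *
        ∑' n : ℕ+, (n : ℂ) ^ (s - 1) * Complex.exp (2 * Real.pi * Complex.I * n * z) := by
  have hsum := summable_norm_add_int_cpow z hs
  have hO := lipschitzKernel_isBigO s z.im_pos
  have hinj : Function.Injective (fun n : ℕ+ ↦ ((n : ℕ) : ℤ)) := fun a b h ↦ by simpa using h
  have hpnat (n : ℕ+) : lipschitzKernel z s (((n : ℕ) : ℤ) : ℝ) =
      (n : ℂ) ^ (s - 1) * Complex.exp (2 * Real.pi * Complex.I * n * z) := by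
    rw [lipschitzKernel, indicator_of_mem (by simp)]
    simp
  have hker : Summable (fun n : ℤ ↦ ‖lipschitzKernel z s n‖) :=
    summable_of_isBigO (Real.summable_abs_int_rpow one_lt_two)
      (hO.norm_left.comp_tendsto Int.tendsto_coe_cofinite)
  have hfourier (n : ℤ) := fourier_lipschitzKernel z.im_pos (zero_lt_one.trans hs) n
  have hreflect (n : ℤ) : (z : ℂ) - (n : ℝ) = z + (-n : ℤ) := by push_cast; ring
  have hsummable : Summable (fun n : ℤ ↦ FourierTransform.fourier (lipschitzKernel z s) n) := by
    simp only [hfourier, hreflect]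
    exact (((Equiv.neg ℤ).summable_iff (f := fun n : ℤ ↦ ((z : ℂ) + n) ^ (-s))).2
      hsum.of_norm).mul_left _
  have hpoisson := Real.tsum_eq_tsum_fourier_of_rpow_decay_of_summable
    (continuous_lipschitzKernel z hs) one_lt_two hO hsummable 0
  refine ⟨hsum, by simpa only [Function.comp_def, hpnat] using hker.comp_injective hinj, ?_⟩
  have hleft : ∑' n : ℤ, lipschitzKernel z s n =
      ∑' n : ℕ+, (n : ℂ) ^ (s - 1) * Complex.exp (2 * Real.pi * Complex.I * n * z) := by
    rw [← hinj.tsum_eq]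
    · exact tsum_congr hpnat
    · intro n hn
      have hn0 : 0 < n := by
        by_contra hn0
        exact hn (indicator_of_notMem (by simpa using hn0) _)
      exact ⟨⟨n.toNat, by omega⟩, by simpa using hn0.le⟩
  have hright : ∑' n : ℤ, FourierTransform.fourier (lipschitzKernel z s) n =
      cexp (π * I * s / 2) * ((2 * π : ℝ) : ℂ) ^ (-s) * Complex.Gamma s *
        ∑' n : ℤ, ((z : ℂ) + n) ^ (-s) := by
    simp only [hfourier, hreflect]
    rw [tsum_mul_left, ← (Equiv.neg ℤ).tsum_eq (fun n : ℤ ↦ ((z : ℂ) + n) ^ (-s))]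
    rfl
  simp only [zero_add, AddCircle.coe_zero, fourier_eval_zero, mul_one] at hpoisson
  rw [← hleft, hpoisson, hright]
  have hGamma := Complex.Gamma_ne_zero_of_re_pos (zero_lt_one.trans hs)
  have h2pi : ((2 * π : ℝ) : ℂ) ^ s ≠ 0 := by simp [cpow_eq_zero_iff, pi_ne_zero]
  have hexp : cexp (-π * I * s / 2) * cexp (π * I * s / 2) = 1 := by
    rw [← Complex.exp_add, ← Complex.exp_zero]
    congr 1
    ring
  rw [cpow_neg]
  generalize cexp (-π * I * s / 2) = a at hexp ⊢
  generalize cexp (π * I * s / 2) = b at hexp ⊢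
  field_simp
  linear_combination (-∑' n : ℤ, ((z : ℂ) + n) ^ (-s)) * hexp
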